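/- For every n ≥ 2, s(n) ≤ s*(2n): for every hypergraph H on n vertices with n hyperedges there exists a graph G on 2n vertices such that s(H) ≤ s*(G). Consequently the maximum of s(H) over hypergraphs with n vertices and n hyperedges is at most the maximum of s*(G) over graphs on 2n vertices. -/

import Mathlib

/-- A labeling of the vertices of a hypergraph with hyperedge set `E` by positive integers is
sum-distinguishing if distinct hyperedges receive distinct sums of labels. -/
def SumDistinguishing {V : Type*} (E : Finset (Finset V)) (f : V → ℕ) : Prop :=
  (∀ v, 1 ≤ f v) ∧ ∀ e ∈ E, ∀ e' ∈ E, e ≠ e' → ∑ v ∈ e, f v ≠ ∑ v ∈ e', f v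

/-- `hs E` is the smallest `N` such that the hypergraph with hyperedge set `E` has a
sum-distinguishing labeling with all labels at most `N`. -/
noncomputable def hs {V : Type*} (E : Finset (Finset V)) : ℕ :=
  sInf {N | ∃ f : V → ℕ, SumDistinguishing E f ∧ ∀ v, f v ≤ N}

open Classical in
/-- The closed neighborhood of a vertex `v` in a graph `G`, as a `Finset`. -/
noncomputable def closedNbr {V : Type*} [Fintype V] (G : SimpleGraph V) (v : V) : Finset V :=
  Finset.univ.filter (fun u => u = v ∨ G.Adj u v)

/-- A labeling of the vertices of a graph `G` by positive integers is vertex sum-distinguishing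
if any two vertices with distinct closed neighborhoods receive distinct sums of labels over
their closed neighborhoods. -/
def VertexSumDistinguishing {V : Type*} [Fintype V] (G : SimpleGraph V) (f : V → ℕ) : Prop :=
  (∀ v, 1 ≤ f v) ∧ ∀ u v : V, closedNbr G u ≠ closedNbr G v →
    ∑ x ∈ closedNbr G u, f x ≠ ∑ x ∈ closedNbr G v, f x

/-- `sStar G` is the smallest `N` such that `G` has a vertex sum-distinguishing labeling with
all labels at most `N`. -/
noncomputable def sStar {V : Type*} [Fintype V] (G : SimpleGraph V) : ℕ :=
  sInf {N | ∃ f : V → ℕ, VertexSumDistinguishing G f ∧ ∀ v, f v ≤ N}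

theorem mem_closedNbr {V : Type*} [Fintype V] (G : SimpleGraph V) (u v : V) :
    u ∈ closedNbr G v ↔ u = v ∨ G.Adj u v := by
  simp [closedNbr]

/-- Binary labels show that every graph has a vertex sum-distinguishing labeling. -/
theorem exists_vertexSumDistinguishing {W : Type*} [Fintype W] (G : SimpleGraph W) :
    ∃ N, ∃ f : W → ℕ, VertexSumDistinguishing G f ∧ ∀ v, f v ≤ N := by
  let φ : W ↪ ℕ := (Fintype.equivFin W).toEmbedding.trans Fin.valEmbedding
  refine ⟨2 ^ Fintype.card W, fun v => 2 ^ φ v, ⟨fun v => Nat.one_le_two_pow, ?_⟩, fun v =>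
    Nat.pow_le_pow_right two_pos (Fintype.equivFin W v).isLt.le⟩
  intro u v huv hsum
  refine huv (Finset.map_injective φ (Finset.geomSum_injective le_rfl ?_))
  simpa using hsum

/-- If the vertices of a hypergraph embed into a graph so that the hyperedges are realized, up to
a common set `K`, as closed neighborhoods, then `hs` of the hypergraph is at most `sStar` of the
graph. -/
theorem hs_le_sStar_of_closedNbr_eq {V W : Type*} [Fintype W] [DecidableEq W]
    (E : Finset (Finset V)) (G : SimpleGraph W) (ι : V ↪ W) (K : Finset W) (w : E → W)
    (hK : ∀ v, ι v ∉ K) (hw : ∀ e : E, closedNbr G (w e) = e.1.map ι ∪ K) :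
    hs E ≤ sStar G := by
  have hdisj (e : Finset V) : Disjoint (e.map ι) K := by
    rw [Finset.disjoint_left]
    simpa using fun v _ => hK v
  obtain ⟨f, ⟨hpos, hf⟩, hN⟩ := Nat.sInf_mem (exists_vertexSumDistinguishing G)
  refine Nat.sInf_le ⟨f ∘ ι, ⟨fun v => hpos _, ?_⟩, fun v => hN _⟩
  intro e he e' he' hne hsum
  refine hf (w ⟨e, he⟩) (w ⟨e', he'⟩) ?_ ?_
  · rw [hw, hw]
    intro h
    refine hne (Finset.map_injective ι ?_)
    rw [← Finset.union_sdiff_cancel_right (hdisj e), h,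
      Finset.union_sdiff_cancel_right (hdisj e')]
  · rw [hw, hw, Finset.sum_union (hdisj e), Finset.sum_union (hdisj e'), Finset.sum_map,
      Finset.sum_map]
    exact congrArg (· + _) hsum

/-- The incidence graph of a hypergraph, with all hyperedges made pairwise adjacent. -/
def splitIncidenceGraph {V : Type*} (E : Finset (Finset V)) : SimpleGraph (V ⊕ E) where
  Adj
    | .inl _, .inl _ => False
    | .inl v, .inr e => v ∈ e.1
    | .inr e, .inl v => v ∈ e.1
    | .inr e, .inr e' => e ≠ e'
  symm := ⟨by rintro (v | e) (v' | e') h <;> first | exact h | exact Ne.symm h⟩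
  loopless := ⟨by rintro (v | e) h <;> simp at h⟩

/-- A hypergraph on `n` vertices with `n` hyperedges is realized by a graph on `2 * n` vertices. -/
theorem exists_hs_le_sStar {n : ℕ} (E : Finset (Finset (Fin n))) (hE : E.card = n) :
    ∃ G : SimpleGraph (Fin (2 * n)), hs E ≤ sStar G := by
  have hcard : Fintype.card (Fin (2 * n)) = Fintype.card (Fin n ⊕ E) := by
    simp [hE, two_mul]
  let φ : Fin (2 * n) ≃ Fin n ⊕ E := Fintype.equivOfCardEq hcard
  refine ⟨(splitIncidenceGraph E).comap φ, hs_le_sStar_of_closedNbr_eq E _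
    (Function.Embedding.inl.trans φ.symm.toEmbedding)
    (Finset.univ.filter fun x => (φ x).isRight) (fun e => φ.symm (.inr e)) ?_ ?_⟩
  · simp
  · intro e
    ext x
    obtain ⟨y | e', rfl⟩ := φ.symm.surjective x
    · have hadj : (splitIncidenceGraph E).Adj (.inl y) (.inr e) ↔ y ∈ e.1 := Iff.rfl
      simp [mem_closedNbr, hadj]
    · have hadj : (splitIncidenceGraph E).Adj (.inr e') (.inr e) ↔ e' ≠ e := Iff.rfl
      simp [mem_closedNbr, hadj, em]

/-- For every `n ≥ 2`: for every hypergraph `H` on `n` vertices with `n` hyperedges there exists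
a graph `G` on `2n` vertices such that `s(H) ≤ s*(G)`; consequently the maximum of `s(H)` over
hypergraphs with `n` vertices and `n` hyperedges is at most the maximum of `s*(G)` over graphs
on `2n` vertices. -/
theorem stmt6 (n : ℕ) (hn : 2 ≤ n) :
    (∀ E : Finset (Finset (Fin n)), E.card = n →
        ∃ G : SimpleGraph (Fin (2 * n)), hs E ≤ sStar G) ∧
    sSup {k | ∃ E : Finset (Finset (Fin n)), E.card = n ∧ k = hs E} ≤
      sSup {k | ∃ G : SimpleGraph (Fin (2 * n)), k = sStar G} := by
  refine ⟨fun E hE => exists_hs_le_sStar E hE, csSup_le' ?_⟩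
  rintro _ ⟨E, hE, rfl⟩
  obtain ⟨G, hG⟩ := exists_hs_le_sStar E hE
  refine hG.trans (le_csSup ?_ ⟨G, rfl⟩)
  exact ((Set.finite_range fun G : SimpleGraph (Fin (2 * n)) => sStar G).subset
    (by rintro _ ⟨G, rfl⟩; exact ⟨G, rfl⟩)).bddAbove
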